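/- For every α with 0 < α < 1, the Tsallis entropy of the Poisson distribution satisfies lim_{λ→∞} (1-α)·√α·(2πλ)^{(α-1)/2} · H_T(α,λ) = 1; that is, H_T(α,λ) ~ (2πλ)^{(1-α)/2} / (√α·(1-α)) as λ → ∞, and in particular H_T(α,λ) → ∞. -/

import Mathlib

open Real Filter Topology

/-- The Poisson probabilities `p_i(λ) = e^{-λ} λ^i / i!`. -/
noncomputable def poissonP (l : ℝ) (i : ℕ) : ℝ :=
  Real.exp (-l) * l ^ i / (Nat.factorial i)

/-- `ψ(α,λ) = ∑_{i=0}^∞ (p_i(λ))^α`. -/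
noncomputable def psiPoisson (α l : ℝ) : ℝ :=
  ∑' i, (poissonP l i) ^ α

open MeasureTheory Set

theorem integrable_exp_neg_mul_abs {c : ℝ} (hc : 0 < c) :
    Integrable (fun x : ℝ => exp (-(c * |x|))) := by
  rw [← integrableOn_univ, ← Iic_union_Ioi (a := (0 : ℝ)), integrableOn_union]
  constructor
  · refine (integrableOn_exp_mul_Iic hc 0).congr_fun (fun x hx => ?_) measurableSet_Iic
    simp [abs_of_nonpos (mem_Iic.1 hx)]
  · refine (integrableOn_exp_mul_Ioi (neg_neg_of_pos hc) 0).congr_fun (fun x hx => ?_)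
      measurableSet_Ioi
    simp [abs_of_pos (mem_Ioi.1 hx)]

/-- The integral of a function which is constant on each `[n, n + 1)` and vanishes on the negative
half-line is the sum of its values. -/
theorem hasSum_of_integrable_floor {a : ℕ → ℝ}
    (h : Integrable ((Ici (0 : ℝ)).indicator fun x => a ⌊x⌋₊)) :
    HasSum a (∫ x, (Ici (0 : ℝ)).indicator (fun x => a ⌊x⌋₊) x) := by
  have hU : ⋃ n : ℕ, Ico (n : ℝ) (n + 1) = Ici 0 := by
    ext x
    simp only [mem_iUnion, mem_Ico, mem_Ici]
    exact ⟨fun ⟨n, hn, _⟩ => n.cast_nonneg.trans hn,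
      fun hx => ⟨⌊x⌋₊, Nat.floor_le hx, Nat.lt_floor_add_one x⟩⟩
  have hd : Pairwise (Function.onFun Disjoint fun n : ℕ => Ico (n : ℝ) (n + 1)) :=
    fun m n hmn => by
      refine Set.disjoint_left.2 fun x hm hn => hmn ?_
      rw [← (Nat.floor_eq_iff (m.cast_nonneg.trans hm.1)).2 hm,
        (Nat.floor_eq_iff (n.cast_nonneg.trans hn.1)).2 hn]
  rw [integrable_indicator_iff measurableSet_Ici, ← hU] at h
  have key := hasSum_integral_iUnion (fun n : ℕ => measurableSet_Ico) hd h
  rw [hU] at key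
  rw [integral_indicator measurableSet_Ici]
  suffices ha : (fun n : ℕ => ∫ x in Ico (n : ℝ) (n + 1), a ⌊x⌋₊) = a by
    rwa [ha] at key
  ext n
  rw [setIntegral_congr_fun (g := fun _ => a n) measurableSet_Ico]
  · simp
  · intro x hx
    simp only [(Nat.floor_eq_iff (n.cast_nonneg.trans hx.1)).2 hx]

theorem sqrt_sub_sqrt_sq_le {x y : ℝ} (hx : 0 ≤ x) (hy : 0 < y) :
    (√x - √y) ^ 2 ≤ x * log (x / y) - x + y := by
  rcases hx.eq_or_lt with rfl | hx
  · simp [sq_sqrt hy.le]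
  have h := one_sub_inv_le_log_of_pos (show 0 < √(x / y) by positivity)
  rw [log_sqrt (by positivity), sqrt_div hx.le, inv_div] at h
  have h2 : x * (1 - √y / √x) = x - √x * √y := by
    rw [show x * (1 - √y / √x) = x - x / √x * √y by ring, div_sqrt]
  have h3 := mul_le_mul_of_nonneg_left h hx.le
  nlinarith [sq_sqrt hx.le, sq_sqrt hy.le]

theorem poissonP_pos {l : ℝ} (hl : 0 < l) (i : ℕ) : 0 < poissonP l i := by
  unfold poissonP; positivity

theorem sqrt_mul_poissonP_eq {l : ℝ} (hl : 0 < l) {i : ℕ} (hi : i ≠ 0) :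
    √l * poissonP l i = √(l / i) / (√2 * Stirling.stirlingSeq i) *
      exp (-(i * log (i / l) - i + l)) := by
  have hi' : (0 : ℝ) < i := by positivity
  have e1 : exp (-(i * log (i / l) - i + l)) = exp (-l) * l ^ i * exp 1 ^ i / (i : ℝ) ^ i := by
    rw [show -(i * log (i / l) - i + l) = -l + i * 1 - i * log (i / l) by ring, exp_sub, exp_add,
      exp_nat_mul, exp_nat_mul, exp_log (by positivity), div_pow]
    field_simp
  rw [e1, Stirling.stirlingSeq, poissonP, sqrt_mul (by norm_num), sqrt_div hl.le, div_pow]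
  field_simp

theorem one_add_abs_le_two_mul_exp (d : ℝ) : 1 + |d| ≤ 2 * exp (d ^ 2 / 2) := by
  nlinarith [add_one_le_exp (d ^ 2 / 2), sq_abs d, sq_nonneg (|d| - 1)]

theorem sqrt_mul_poissonP_le {l : ℝ} (hl : 0 < l) (i : ℕ) :
    √l * poissonP l i ≤ 2 * exp (-((√i - √l) ^ 2 / 2)) := by
  set d := √i - √l with hd
  suffices h : √l * poissonP l i ≤ (1 + |d|) * exp (-d ^ 2) by
    refine h.trans ((mul_le_mul_of_nonneg_right (one_add_abs_le_two_mul_exp d)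
      (exp_pos _).le).trans_eq ?_)
    rw [mul_assoc, ← exp_add]
    ring_nf
  rcases eq_or_ne i 0 with rfl | hi
  · have hd' : d = -√l := by simp [hd]
    rw [hd', abs_neg, abs_of_nonneg (sqrt_nonneg l), neg_sq, sq_sqrt hl.le]
    simp only [poissonP, pow_zero, mul_one, Nat.factorial_zero, Nat.cast_one, div_one]
    gcongr
    linarith
  rw [sqrt_mul_poissonP_eq hl hi]
  have hi1 : (1 : ℝ) ≤ √i := one_le_sqrt.2 (by exact_mod_cast Nat.one_le_iff_ne_zero.2 hi)
  gcongr
  · have h1 : (1 : ℝ) ≤ √2 * Stirling.stirlingSeq i :=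
      one_le_mul_of_one_le_of_one_le (one_le_sqrt.2 (by norm_num))
        ((one_le_sqrt.2 (by linarith [pi_gt_three])).trans (Stirling.sqrt_pi_le_stirlingSeq hi))
    refine (div_le_self (sqrt_nonneg _) h1).trans ?_
    rw [sqrt_div hl.le, div_le_iff₀ (by linarith)]
    nlinarith [neg_abs_le d, abs_nonneg d]
  · exact sqrt_sub_sqrt_sq_le i.cast_nonneg hl

theorem abs_div_four_sub_le_sq {l u : ℝ} (hl : 1 ≤ l) (hx : 0 ≤ l + √l * u) :
    |u| / 4 - 3 / 2 ≤ (√(⌊l + √l * u⌋₊ : ℝ) - √l) ^ 2 := by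
  set x := l + √l * u with hxd
  have h1 : √(⌊x⌋₊ : ℝ) ≤ √x := sqrt_le_sqrt (Nat.floor_le hx)
  have h2 : √x ≤ √(⌊x⌋₊ : ℝ) + 1 := by
    refine (sqrt_le_sqrt (Nat.lt_floor_add_one x).le).trans ?_
    rw [sqrt_le_left (by positivity)]
    nlinarith [sq_sqrt (Nat.cast_nonneg (α := ℝ) ⌊x⌋₊), sqrt_nonneg (⌊x⌋₊ : ℝ)]
  have hr : 1 ≤ √l := one_le_sqrt.2 hl
  have hl2 := sq_sqrt (zero_le_one.trans hl)
  have hx2 := sq_sqrt hx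
  have hs := sqrt_nonneg x
  have h3 : (|u| - 2) / 2 ≤ (√x - √l) ^ 2 := by
    have h4 : (√x - √l) ^ 2 * (√x + √l) ^ 2 = √l ^ 2 * u ^ 2 := by
      rw [← mul_pow, ← mul_pow]; congr 1; nlinarith
    have h5 : (√x + √l) ^ 2 ≤ √l ^ 2 * (2 * (2 + |u|)) := by
      have : √l * u ≤ √l ^ 2 * |u| := by
        nlinarith [le_abs_self u, abs_nonneg u, mul_nonneg (sub_nonneg.2 hr) (abs_nonneg u)]
      nlinarith [sq_nonneg (√x - √l)]
    have hu := abs_nonneg u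
    have h6 : √l ^ 2 * u ^ 2 ≤ (√x - √l) ^ 2 * (√l ^ 2 * (2 * (2 + |u|))) :=
      h4 ▸ mul_le_mul_of_nonneg_left h5 (sq_nonneg _)
    have h7 : u ^ 2 ≤ (√x - √l) ^ 2 * (2 * (2 + |u|)) := by
      refine le_of_mul_le_mul_left ?_ (show 0 < √l ^ 2 by positivity)
      linarith
    refine le_of_mul_le_mul_right ?_ (show 0 < 2 * (2 + |u|) by positivity)
    nlinarith [sq_abs u]
  have h8 : (√x - √(⌊x⌋₊ : ℝ)) ^ 2 ≤ 1 := by nlinarith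
  nlinarith [sq_nonneg ((√(⌊x⌋₊ : ℝ) - √l) - (√x - √(⌊x⌋₊ : ℝ)))]

theorem abs_mul_log_sub_le {s : ℝ} (hs : |s| ≤ 1 / 2) :
    |(1 + s) * log (1 + s) - s - s ^ 2 / 2| ≤ 4 * |s| ^ 3 := by
  have h := abs_log_sub_add_sum_range_le (x := -s) (by rw [abs_neg]; linarith) 2
  simp only [Finset.sum_range_succ, Finset.sum_range_zero, sub_neg_eq_add, abs_neg] at h
  norm_num at h
  set r := -s + s ^ 2 / 2 + log (1 + s) with hr
  have h0 := abs_nonneg s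
  have h1 : |r| ≤ 2 * |s| ^ 3 := by
    refine h.trans ((div_le_iff₀ (by linarith)).2 ?_)
    nlinarith [pow_nonneg h0 3]
  have h2 : (1 + s) * log (1 + s) - s - s ^ 2 / 2 = (1 + s) * r - s ^ 3 / 2 := by rw [hr]; ring
  rw [h2]
  have h3 : |1 + s| ≤ 3 / 2 := (abs_add_le _ _).trans (by rw [abs_one]; linarith)
  refine (abs_sub _ _).trans ?_
  rw [abs_mul, abs_div, abs_pow, abs_two]
  nlinarith [mul_le_mul h3 h1 (abs_nonneg _) (by norm_num), pow_nonneg h0 3]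

/-- Local limit theorem: if `(i - l) / √l → u` as `l → ∞`, then `√l · p_i(l)` tends to the standard
Gaussian density at `u`. -/
theorem tendsto_sqrt_mul_poissonP {i : ℝ → ℕ} {u : ℝ}
    (h : Tendsto (fun l => ((i l : ℝ) - l) / √l) atTop (𝓝 u)) :
    Tendsto (fun l => √l * poissonP l (i l)) atTop (𝓝 ((√(2 * π))⁻¹ * exp (-(u ^ 2 / 2)))) := by
  have hs0 : Tendsto (fun l : ℝ => ((i l : ℝ) - l) / l) atTop (𝓝 0) := by
    have h1 := h.mul (tendsto_inv_atTop_zero.comp tendsto_sqrt_atTop)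
    rw [mul_zero] at h1
    refine h1.congr' ?_
    filter_upwards [eventually_gt_atTop 0] with l hl
    simp only [Function.comp]
    rw [← div_eq_mul_inv, div_div, mul_self_sqrt hl.le]
  have hratio : Tendsto (fun l : ℝ => (i l : ℝ) / l) atTop (𝓝 1) := by
    have h1 := hs0.const_add 1
    rw [add_zero] at h1
    refine h1.congr' ?_
    filter_upwards [eventually_gt_atTop 0] with l hl
    field_simp
    ring
  have hi : Tendsto i atTop atTop := by
    rw [← tendsto_natCast_atTop_iff (R := ℝ)]
    refine (hratio.pos_mul_atTop one_pos tendsto_id).congr' ?_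
    filter_upwards [eventually_gt_atTop 0] with l hl
    simp [hl.ne']
  have hexp : Tendsto (fun l : ℝ => i l * log (i l / l) - i l + l) atTop (𝓝 (u ^ 2 / 2)) := by
    have herr : Tendsto (fun l : ℝ => i l * log (i l / l) - i l + l -
        (((i l : ℝ) - l) / √l) ^ 2 / 2) atTop (𝓝 0) := by
      have hb : Tendsto (fun l : ℝ => 4 * ((((i l : ℝ) - l) / √l) ^ 2 * |((i l : ℝ) - l) / l|))
          atTop (𝓝 0) := by
        simpa using ((h.pow 2).mul hs0.abs).const_mul 4
      refine squeeze_zero_norm' ?_ hb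
      have hev := hs0.abs.eventually_le_const (show |(0 : ℝ)| < 1 / 2 by norm_num)
      filter_upwards [eventually_gt_atTop 0, hev] with l hl hs
      set s := ((i l : ℝ) - l) / l with hsd
      have h1 : (i l : ℝ) = l * (1 + s) := by rw [hsd]; field_simp; ring
      have h2 : (((i l : ℝ) - l) / √l) ^ 2 = l * s ^ 2 := by
        rw [div_pow, sq_sqrt hl.le, hsd]; field_simp
      rw [h2, h1, mul_div_cancel_left₀ _ hl.ne', norm_eq_abs]
      rw [show l * (1 + s) * log (1 + s) - l * (1 + s) + l - l * s ^ 2 / 2 =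
        l * ((1 + s) * log (1 + s) - s - s ^ 2 / 2) by ring, abs_mul, abs_of_pos hl]
      refine (mul_le_mul_of_nonneg_left (abs_mul_log_sub_le hs) hl.le).trans_eq ?_
      rw [← sq_abs s]
      ring
    simpa using herr.add ((h.pow 2).div_const 2)
  have hsqrt : Tendsto (fun l : ℝ => √(l / i l)) atTop (𝓝 1) := by
    simpa using (hratio.inv₀ one_ne_zero).sqrt
  have hst := (Stirling.tendsto_stirlingSeq_sqrt_pi.comp hi).const_mul (√2)
  have hmain := (hsqrt.div hst (by positivity)).mul ((continuous_exp.tendsto _).comp hexp.neg)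
  rw [one_div, ← sqrt_mul (by norm_num : (0 : ℝ) ≤ 2)] at hmain
  refine hmain.congr' ?_
  filter_upwards [eventually_gt_atTop 0, hi.eventually_ne_atTop 0] with l hl hil
  exact (sqrt_mul_poissonP_eq hl hil).symm

/-- The function of `x` which equals `(√l · p_i(l)) ^ α` on `[i, i + 1)` and vanishes on the
negative half-line. -/
noncomputable def poissonStep (α l : ℝ) : ℝ → ℝ :=
  (Ici (0 : ℝ)).indicator fun x => (√l * poissonP l ⌊x⌋₊) ^ α

theorem measurable_poissonStep (α l : ℝ) : Measurable (poissonStep α l) :=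
  ((measurable_from_nat (f := fun i => (√l * poissonP l i) ^ α)).comp
    Nat.measurable_floor).indicator measurableSet_Ici

theorem norm_poissonStep_le {α l : ℝ} (hα : 0 < α) (hl : 1 ≤ l) (u : ℝ) :
    ‖poissonStep α l (l + √l * u)‖ ≤ (2 * exp (3 / 4)) ^ α * exp (-(α / 8 * |u|)) := by
  unfold poissonStep
  by_cases hx : l + √l * u ∈ Ici (0 : ℝ)
  · have hp := poissonP_pos (zero_lt_one.trans_le hl) ⌊l + √l * u⌋₊
    rw [indicator_of_mem hx, norm_of_nonneg (by positivity),
      show -(α / 8 * |u|) = -(|u| / 8) * α by ring, exp_mul,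
      ← mul_rpow (by positivity) (by positivity), mul_assoc, ← exp_add]
    refine rpow_le_rpow (by positivity)
      ((sqrt_mul_poissonP_le (zero_lt_one.trans_le hl) _).trans ?_) hα.le
    gcongr
    linarith [abs_div_four_sub_le_sq hl hx]
  · rw [indicator_of_notMem hx, norm_zero]
    positivity

theorem integrable_poissonStep_bound {α : ℝ} (hα : 0 < α) :
    Integrable fun u : ℝ => (2 * exp (3 / 4)) ^ α * exp (-(α / 8 * |u|)) :=
  (integrable_exp_neg_mul_abs (by positivity)).const_mul _

theorem integral_poissonStep {α l : ℝ} (hα : 0 < α) (hl : 1 ≤ l) :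
    ∫ u, poissonStep α l (l + √l * u) = √l ^ (α - 1) * psiPoisson α l := by
  have hl0 : 0 < l := zero_lt_one.trans_le hl
  have hr : 0 < √l := sqrt_pos.2 hl0
  have hint : Integrable fun u => poissonStep α l (l + √l * u) :=
    (integrable_poissonStep_bound hα).mono'
      ((measurable_poissonStep α l).comp (by fun_prop)).aestronglyMeasurable
      (Eventually.of_forall (norm_poissonStep_le hα hl))
  have hint' : Integrable (poissonStep α l) := by
    have := (integrable_comp_mul_left_iff (fun y => poissonStep α l (l + y)) hr.ne').1 hint
    simpa using this.comp_add_left (-l)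
  have hsum := (hasSum_of_integrable_floor (a := fun i => (√l * poissonP l i) ^ α) hint').tsum_eq
  rw [Measure.integral_comp_mul_left (fun y => poissonStep α l (l + y)),
    integral_add_left_eq_self (poissonStep α l) l, poissonStep, ← hsum, psiPoisson,
    abs_of_pos (inv_pos.2 hr), smul_eq_mul, ← tsum_mul_left, ← tsum_mul_left]
  congr 1
  ext i
  rw [mul_rpow hr.le (poissonP_pos hl0 i).le, rpow_sub_one hr.ne']
  ring

theorem eventually_add_sqrt_mul_nonneg (u : ℝ) :
    ∀ᶠ l : ℝ in atTop, 0 ≤ l + √l * u := by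
  filter_upwards [tendsto_sqrt_atTop.eventually_ge_atTop (-u), eventually_ge_atTop 0] with l h hl
  nlinarith [sqrt_nonneg l, mul_self_sqrt hl]

theorem tendsto_sub_div_sqrt_floor (u : ℝ) :
    Tendsto (fun l : ℝ => ((⌊l + √l * u⌋₊ : ℝ) - l) / √l) atTop (𝓝 u) := by
  have hinv : Tendsto (fun l : ℝ => (√l)⁻¹) atTop (𝓝 0) :=
    tendsto_inv_atTop_zero.comp tendsto_sqrt_atTop
  have hlow : Tendsto (fun l : ℝ => u - (√l)⁻¹) atTop (𝓝 u) := by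
    simpa using hinv.const_sub u
  refine tendsto_of_tendsto_of_tendsto_of_le_of_le' hlow tendsto_const_nhds ?_ ?_
  all_goals
    filter_upwards [eventually_add_sqrt_mul_nonneg u, eventually_gt_atTop 0] with l hx hl
    have hr := sqrt_pos.2 hl
  · rw [le_div_iff₀ hr, sub_mul, inv_mul_cancel₀ hr.ne']
    linarith [Nat.lt_floor_add_one (l + √l * u)]
  · rw [div_le_iff₀ hr]
    linarith [Nat.floor_le hx]

theorem tendsto_sqrt_rpow_mul_psiPoisson {α : ℝ} (hα : 0 < α) :
    Tendsto (fun l => √l ^ (α - 1) * psiPoisson α l) atTop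
      (𝓝 ((√(2 * π))⁻¹ ^ α * √(π / (α / 2)))) := by
  have hlim : ∀ u : ℝ, Tendsto (fun l => poissonStep α l (l + √l * u)) atTop
      (𝓝 ((√(2 * π))⁻¹ ^ α * exp (-(α / 2) * u ^ 2))) := fun u => by
    have h := (tendsto_sqrt_mul_poissonP (tendsto_sub_div_sqrt_floor u)).rpow_const (p := α)
      (Or.inr hα.le)
    rw [mul_rpow (by positivity) (exp_pos _).le, ← exp_mul,
      show -(u ^ 2 / 2) * α = -(α / 2) * u ^ 2 by ring] at h
    refine h.congr' ?_
    filter_upwards [eventually_add_sqrt_mul_nonneg u] with l hl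
    rw [poissonStep, indicator_of_mem (mem_Ici.2 hl)]
  have key := tendsto_integral_filter_of_dominated_convergence _
    (Eventually.of_forall fun l => ((measurable_poissonStep α l).comp
      (by fun_prop : Measurable fun u => l + √l * u)).aestronglyMeasurable)
    ((eventually_ge_atTop 1).mono fun l hl =>
      Eventually.of_forall (norm_poissonStep_le hα hl))
    (integrable_poissonStep_bound hα) (Eventually.of_forall hlim)
  rw [integral_const_mul, integral_gaussian] at key
  refine key.congr' ?_
  filter_upwards [eventually_ge_atTop 1] with l hl
  exact integral_poissonStep hα hl

theorem tendsto_rpow_mul_psiPoisson {α : ℝ} (hα : 0 < α) :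
    Tendsto (fun l => √α * (2 * π * l) ^ ((α - 1) / 2) * psiPoisson α l) atTop (𝓝 1) := by
  have hc : √α * √(2 * π) ^ (α - 1) * ((√(2 * π))⁻¹ ^ α * √(π / (α / 2))) = 1 := by
    have h2 : 0 < √(2 * π) := by positivity
    rw [inv_rpow h2.le, rpow_sub_one h2.ne', show π / (α / 2) = 2 * π / α by field_simp,
      sqrt_div (by positivity)]
    have := rpow_pos_of_pos h2 α
    have := sqrt_pos.2 hα
    field_simp
  have h := (tendsto_sqrt_rpow_mul_psiPoisson hα).const_mul (√α * √(2 * π) ^ (α - 1))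
  rw [hc] at h
  refine h.congr' ?_
  filter_upwards [eventually_gt_atTop 0] with l hl
  rw [← mul_assoc, mul_assoc (√α), ← mul_rpow (by positivity) (by positivity),
    ← sqrt_mul (by positivity), sqrt_eq_rpow (2 * π * l), ← rpow_mul (by positivity)]
  ring_nf

/-- asymptotics of the Tsallis entropy of the Poisson distribution
for 0 < α < 1. -/
theorem tsallis_poisson_asymptotic (α : ℝ) (hα : 0 < α) (hα1 : α < 1) :
    Tendsto (fun l : ℝ => (1 - α) * Real.sqrt α * (2 * Real.pi * l) ^ ((α - 1) / 2) *
        ((1 - α)⁻¹ * (psiPoisson α l - 1)))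
      atTop (𝓝 1) ∧
    Tendsto (fun l : ℝ => (1 - α)⁻¹ * (psiPoisson α l - 1)) atTop atTop := by
  have h1 : 0 < 1 - α := sub_pos.2 hα1
  have hsα : 0 < √α := sqrt_pos.2 hα
  have h2l : Tendsto (fun l : ℝ => 2 * π * l) atTop atTop :=
    tendsto_id.const_mul_atTop (by positivity)
  have hnorm : Tendsto (fun l : ℝ => (2 * π * l) ^ ((α - 1) / 2)) atTop (𝓝 0) := by
    convert (tendsto_rpow_neg_atTop (show 0 < (1 - α) / 2 by positivity)).comp h2l using 2 with l
    simp only [Function.comp]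
    ring_nf
  have hmain : Tendsto (fun l : ℝ => (1 - α) * √α * (2 * π * l) ^ ((α - 1) / 2) *
      ((1 - α)⁻¹ * (psiPoisson α l - 1))) atTop (𝓝 1) := by
    have h := (tendsto_rpow_mul_psiPoisson hα).sub (hnorm.const_mul √α)
    rw [mul_zero, sub_zero] at h
    refine h.congr fun l => ?_
    field_simp
  refine ⟨hmain, ?_⟩
  have hinv : Tendsto (fun l : ℝ => ((1 - α) * √α)⁻¹ * (2 * π * l) ^ ((1 - α) / 2)) atTop atTop :=
    ((tendsto_rpow_atTop (by positivity)).comp h2l).const_mul_atTop (by positivity)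
  refine (hmain.pos_mul_atTop one_pos hinv).congr' ?_
  filter_upwards [eventually_gt_atTop 0] with l hl
  have h2 : (0 : ℝ) < 2 * π * l := by positivity
  rw [show (α - 1) / 2 = -((1 - α) / 2) by ring, rpow_neg h2.le]
  have := rpow_pos_of_pos h2 ((1 - α) / 2)
  field_simp
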